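/- arXiv:2004.08519 — 8 statements merged into one kernel-verified Lean document; each statement's English description precedes it below -/
import Mathlib

section
/- (Theorem 3) For u, v ∈ Γ, the pair (u,v) is a covering pair of the poset (Γ, ≼_UM) (that is, u ≺_UM v and every w ∈ Γ with u ≼_UM w ≼_UM v satisfies w ∈ {u,v}) if and only if either (UM1) u_n ≤ m−1 and v = Up(u,n), or (UM2) there exists s ∈ [1,n−1] with u_s ≤ m−1, u_{s+1} ≥ 1, and v = Move(u,s,s+1). -/
open Finset

/-- `Up u s` increases the `s`-th entry of the PV sequence `u` by one. -/
def Up {n : ℕ} (u : Fin n → ℕ) (s : Fin n) : Fin n → ℕ :=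
  fun j => if j = s then u s + 1 else u j

/-- `Move u s t` moves one pageview from period `t` to the more recent period `s`. -/
def Move {n : ℕ} (u : Fin n → ℕ) (s t : Fin n) : Fin n → ℕ :=
  fun j => if j = s then u s + 1 else if j = t then u t - 1 else u j

/-- `Swap u s t` exchanges the entries of `u` at positions `s` and `t`. -/
def Swap {n : ℕ} (u : Fin n → ℕ) (s t : Fin n) : Fin n → ℕ :=
  fun j => if j = s then u t else if j = t then u s else u j

/-- Membership in `Γ = {0,1,...,m}^n`. -/
def InGamma {n : ℕ} (m : ℕ) (u : Fin n → ℕ) : Prop := ∀ j, u j ≤ m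

/-- Strict lexicographic order: `u ≺_lex v` iff there is `s` with `u s < v s`
and `u j = v j` for all `j < s`. -/
def LexLt {n : ℕ} (u v : Fin n → ℕ) : Prop :=
  ∃ s : Fin n, u s < v s ∧ ∀ j : Fin n, j < s → u j = v j

/-- `u ≼_lex v` iff `u ≺_lex v` or `u = v`. -/
def LexLe {n : ℕ} (u v : Fin n → ℕ) : Prop := LexLt u v ∨ u = v

/-- One step of the `Up`/`Move` relation. -/
def UMStep {n : ℕ} (m : ℕ) (u v : Fin n → ℕ) : Prop :=
  (∃ s : Fin n, u s ≤ m - 1 ∧ v = Up u s) ∨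
  (∃ s t : Fin n, s < t ∧ u s ≤ m - 1 ∧ 1 ≤ u t ∧ v = Move u s t)

/-- `u ≺_UM v`: transitive closure of the `Up`/`Move` steps. -/
def UMLt {n : ℕ} (m : ℕ) : (Fin n → ℕ) → (Fin n → ℕ) → Prop :=
  Relation.TransGen (UMStep m)

/-- `u ≼_UM v` iff `u ≺_UM v` or `u = v`. -/
def UMLe {n : ℕ} (m : ℕ) (u v : Fin n → ℕ) : Prop := UMLt m u v ∨ u = v

/-- One step of the `Up`/`Swap` relation. -/
def USStep {n : ℕ} (m : ℕ) (u v : Fin n → ℕ) : Prop :=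
  (∃ s : Fin n, u s ≤ m - 1 ∧ v = Up u s) ∨
  (∃ s t : Fin n, s < t ∧ u s < u t ∧ v = Swap u s t)

/-- `u ≺_US v`: transitive closure of the `Up`/`Swap` steps. -/
def USLt {n : ℕ} (m : ℕ) : (Fin n → ℕ) → (Fin n → ℕ) → Prop :=
  Relation.TransGen (USStep m)

/-- `u ≼_US v` iff `u ≺_US v` or `u = v`. -/
def USLe {n : ℕ} (m : ℕ) (u v : Fin n → ℕ) : Prop := USLt m u v ∨ u = v

/-- The weighted sum of the entries, with weights decreasing from `n` to `1`. -/
def weight {n : ℕ} (u : Fin n → ℕ) : ℕ := ∑ j : Fin n, (n - (j : ℕ)) * u j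

theorem weight_add_single {n : ℕ} (u : Fin n → ℕ) (s : Fin n) :
    weight (u + Pi.single s 1) = weight u + (n - (s : ℕ)) := by
  simp [weight, mul_add, Finset.sum_add_distrib, Pi.single_apply]

theorem weight_Up {n : ℕ} (u : Fin n → ℕ) (s : Fin n) :
    weight (Up u s) = weight u + (n - (s : ℕ)) := by
  rw [← weight_add_single]
  congr 1
  funext j
  simp only [Up, Pi.add_apply, Pi.single_apply]
  grind

theorem weight_Move {n : ℕ} (u : Fin n → ℕ) {s t : Fin n} (hst : s < t) (ht : 1 ≤ u t) :
    weight (Move u s t) = weight u + ((t : ℕ) - (s : ℕ)) := by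
  have h : weight (Move u s t + Pi.single t 1) = weight (u + Pi.single s 1) := by
    congr 1
    funext j
    simp only [Move, Pi.add_apply, Pi.single_apply]
    grind
  rw [weight_add_single, weight_add_single] at h
  have := t.isLt
  have : (s : ℕ) < t := hst
  omega

theorem UMStep.weight_lt {n m : ℕ} {u v : Fin n → ℕ} (h : UMStep m u v) :
    weight u < weight v := by
  rcases h with ⟨s, -, rfl⟩ | ⟨s, t, hst, -, ht, rfl⟩
  · rw [weight_Up]
    have := s.isLt
    omega
  · rw [weight_Move u hst ht]
    have : (s : ℕ) < t := hst
    omega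

theorem UMLt.weight_lt {n m : ℕ} {u v : Fin n → ℕ} (h : UMLt m u v) :
    weight u < weight v := by
  induction h with
  | single h => exact h.weight_lt
  | tail _ h ih => exact ih.trans h.weight_lt

theorem UMStep.inGamma {n m : ℕ} (hm : 0 < m) {u v : Fin n → ℕ} (h : UMStep m u v)
    (hu : InGamma m u) : InGamma m v := by
  intro j
  have := hu j
  rcases h with ⟨s, hs, rfl⟩ | ⟨s, t, -, hs, -, rfl⟩
  · simp only [Up]
    split_ifs <;> omega
  · simp only [Move]
    grind

/-- The elementary steps: `Up` at the last position and `Move` between adjacent positions. -/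
def ElemStep {n : ℕ} (m : ℕ) (u v : Fin n → ℕ) : Prop :=
  (∃ s : Fin n, (s : ℕ) + 1 = n ∧ u s ≤ m - 1 ∧ v = Up u s) ∨
  (∃ s t : Fin n, (s : ℕ) + 1 = (t : ℕ) ∧ u s ≤ m - 1 ∧ 1 ≤ u t ∧ v = Move u s t)

theorem ElemStep.umStep {n m : ℕ} {u v : Fin n → ℕ} (h : ElemStep m u v) : UMStep m u v := by
  rcases h with ⟨s, -, hs, rfl⟩ | ⟨s, t, hst, hs, ht, rfl⟩
  · exact Or.inl ⟨s, hs, rfl⟩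
  · exact Or.inr ⟨s, t, Fin.lt_def.2 (by omega), hs, ht, rfl⟩

theorem ElemStep.weight_eq {n m : ℕ} {u v : Fin n → ℕ} (h : ElemStep m u v) :
    weight v = weight u + 1 := by
  rcases h with ⟨s, hs, -, rfl⟩ | ⟨s, t, hst, -, ht, rfl⟩
  · rw [weight_Up]
    omega
  · rw [weight_Move u (Fin.lt_def.2 (by omega)) ht]
    omega

theorem transGen_elemStep_Up {n m : ℕ} (hm : 0 < m) (d : ℕ) :
    ∀ (u : Fin n → ℕ) (s : Fin n), InGamma m u → (s : ℕ) + 1 + d = n → u s ≤ m - 1 →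
      Relation.TransGen (ElemStep m) u (Up u s) := by
  induction d with
  | zero => exact fun u s _ hd hs => .single (Or.inl ⟨s, hd, hs, rfl⟩)
  | succ d ih =>
    intro u s hu hd hs
    obtain ⟨r, hr⟩ : ∃ r : Fin n, (s : ℕ) + 1 = r := ⟨⟨s + 1, by omega⟩, rfl⟩
    have hsr : s ≠ r := by rintro rfl; omega
    have hur := hu r
    by_cases h : u r ≤ m - 1
    · refine .tail (ih u r hu (by omega) h)
        (Or.inr ⟨s, r, hr, by simpa [Up, hsr] using hs, by simp [Up], ?_⟩)
      funext j
      simp only [Up, Move]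
      grind
    · have hstep : ElemStep m u (Move u s r) := Or.inr ⟨s, r, hr, hs, by omega, rfl⟩
      have := ih (Move u s r) r (hstep.umStep.inGamma hm hu) (by omega)
        (by simp only [Move]; grind)
      convert Relation.TransGen.head hstep this using 1
      funext j
      simp only [Up, Move]
      grind

theorem transGen_elemStep_Move {n m : ℕ} (hm : 0 < m) (t : Fin n) (d : ℕ) :
    ∀ (u : Fin n → ℕ) (s : Fin n), InGamma m u → (s : ℕ) + 1 + d = t → u s ≤ m - 1 →
      1 ≤ u t → Relation.TransGen (ElemStep m) u (Move u s t) := by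
  induction d with
  | zero => exact fun u s _ hd hs ht => .single (Or.inr ⟨s, t, hd, hs, ht, rfl⟩)
  | succ d ih =>
    intro u s hu hd hs ht
    obtain ⟨r, hr⟩ : ∃ r : Fin n, (s : ℕ) + 1 = r := ⟨⟨s + 1, by omega⟩, rfl⟩
    have hsr : s ≠ r := by rintro rfl; omega
    have hst : s ≠ t := by rintro rfl; omega
    have hrt : r ≠ t := by rintro rfl; omega
    have hur := hu r
    by_cases h : u r ≤ m - 1
    · refine .tail (ih u r hu (by omega) h ht)
        (Or.inr ⟨s, r, hr, by simpa [Move, hsr, hst] using hs, by simp [Move], ?_⟩)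
      funext j
      simp only [Move]
      grind
    · have hstep : ElemStep m u (Move u s r) := Or.inr ⟨s, r, hr, hs, by omega, rfl⟩
      have := ih (Move u s r) r (hstep.umStep.inGamma hm hu) (by omega)
        (by simp only [Move]; grind) (by simp only [Move]; grind)
      convert Relation.TransGen.head hstep this using 1
      funext j
      simp only [Move]
      grind

theorem UMStep.transGen_elemStep {n m : ℕ} (hm : 0 < m) {u v : Fin n → ℕ}
    (h : UMStep m u v) (hu : InGamma m u) : Relation.TransGen (ElemStep m) u v := by
  rcases h with ⟨s, hs, rfl⟩ | ⟨s, t, hst, hs, ht, rfl⟩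
  · exact transGen_elemStep_Up hm (n - (s + 1)) u s hu (by omega) hs
  · have : (s : ℕ) < t := hst
    exact transGen_elemStep_Move hm t (t - (s + 1)) u s hu (by omega) hs ht

theorem UMLt.exists_elemStep {n m : ℕ} (hm : 0 < m) {u v : Fin n → ℕ} (h : UMLt m u v)
    (hu : InGamma m u) : ∃ w, ElemStep m u w ∧ UMLe m w v := by
  obtain ⟨x, hux, hxv⟩ := Relation.TransGen.head'_iff.1 h
  obtain ⟨w, huw, hwx⟩ := Relation.TransGen.head'_iff.1 (hux.transGen_elemStep hm hu)
  refine ⟨w, huw, ?_⟩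
  have hwv : Relation.ReflTransGen (UMStep m) w v :=
    (Relation.ReflTransGen.mono (fun _ _ => ElemStep.umStep) _ _ hwx).trans hxv
  rcases Relation.reflTransGen_iff_eq_or_transGen.1 hwv with h | h
  · exact Or.inr h.symm
  · exact Or.inl h

theorem covering_iff_elemStep {n m : ℕ} (hm : 0 < m) {u v : Fin n → ℕ} (hu : InGamma m u) :
    (UMLt m u v ∧
      ∀ w : Fin n → ℕ, InGamma m w → UMLe m u w → UMLe m w v → (w = u ∨ w = v)) ↔
    ElemStep m u v := by
  constructor
  · rintro ⟨huv, hcov⟩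
    obtain ⟨w, huw, hwv⟩ := huv.exists_elemStep hm hu
    rcases hcov w (huw.umStep.inGamma hm hu) (Or.inl (.single huw.umStep)) hwv with rfl | rfl
    · exact absurd huw.weight_eq (by omega)
    · exact huw
  · intro h
    refine ⟨.single h.umStep, fun w _ huw hwv => ?_⟩
    rcases huw with huw | rfl
    · rcases hwv with hwv | rfl
      · have := h.weight_eq
        have := huw.weight_lt
        have := hwv.weight_lt
        omega
      · exact Or.inr rfl
    · exact Or.inl rfl

theorem stmt_7 (n m : ℕ) (hn : 0 < n) (hm : 0 < m)
    (u v : Fin n → ℕ) (hu : InGamma m u) (hv : InGamma m v) :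
    (UMLt m u v ∧
      ∀ w : Fin n → ℕ, InGamma m w → UMLe m u w → UMLe m w v → (w = u ∨ w = v)) ↔
    ((u ⟨n - 1, Nat.sub_lt hn Nat.one_pos⟩ ≤ m - 1 ∧
        v = Up u ⟨n - 1, Nat.sub_lt hn Nat.one_pos⟩) ∨
     (∃ s t : Fin n, (s : ℕ) + 1 = (t : ℕ) ∧ u s ≤ m - 1 ∧ 1 ≤ u t ∧
        v = Move u s t)) := by
  rw [covering_iff_elemStep hm hu, ElemStep]
  refine or_congr_left ⟨?_, fun ⟨hs, h⟩ => ⟨_, Nat.sub_add_cancel hn, hs, h⟩⟩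
  rintro ⟨s, hs, hus, rfl⟩
  obtain rfl : s = ⟨n - 1, Nat.sub_lt hn Nat.one_pos⟩ := Fin.ext (by simp only; omega)
  exact ⟨hus, rfl⟩
end

section
/- Let u ∈ Γ and s ∈ [1,n−1] with u_s ≤ m−1 (so that s < n). Then there exists w ∈ Γ with u ≺_UM w ≺_UM Up(u,s); consequently, (u, Up(u,s)) is not a covering pair of (Γ, ≼_UM) when s < n. -/
open Finset

theorem stmt_9 (n m : ℕ) (hn : 0 < n) (hm : 0 < m)
    (u : Fin n → ℕ) (hu : InGamma m u) (s : Fin n) (hs : (s : ℕ) + 1 < n)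
    (hsm : u s ≤ m - 1) :
    ∃ w : Fin n → ℕ, InGamma m w ∧ UMLt m u w ∧ UMLt m w (Up u s) := by
  obtain ⟨t, hst⟩ : ∃ t : Fin n, s < t := ⟨⟨s + 1, hs⟩, Nat.lt_succ_self s⟩
  have hts : t ≠ s := hst.ne'
  by_cases ht : u t ≤ m - 1
  · refine ⟨Up u t, fun j => ?_, .single (.inl ⟨t, ht, rfl⟩),
      .single (.inr ⟨s, t, hst, ?_, ?_, ?_⟩)⟩
    · have := hu j
      grind [Up]
    · simpa [Up, hts.symm] using hsm
    · simp [Up]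
    · funext j
      grind [Up, Move]
  · refine ⟨Move u s t, fun j => ?_, .single (.inr ⟨s, t, hst, hsm, by lia, rfl⟩),
      .single (.inl ⟨t, ?_, ?_⟩)⟩
    · have := hu j
      grind [Move]
    · have := hu t
      grind [Move]
    · funext j
      grind [Up, Move]
end

section
/- Let u ∈ Γ and s,t ∈ [1,n] with t ≥ s+2, u_s ≤ m−1 and u_t ≥ 1. Then there exists w ∈ Γ with u ≺_UM w ≺_UM Move(u,s,t); consequently, (u, Move(u,s,t)) is not a covering pair of (Γ, ≼_UM) when t > s+1. -/
open Finset

theorem stmt_10 (n m : ℕ) (hn : 0 < n) (hm : 0 < m)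
    (u : Fin n → ℕ) (hu : InGamma m u) (s t : Fin n)
    (hst : (s : ℕ) + 2 ≤ (t : ℕ)) (hsm : u s ≤ m - 1) (ht : 1 ≤ u t) :
    ∃ w : Fin n → ℕ, InGamma m w ∧ UMLt m u w ∧ UMLt m w (Move u s t) := by
  let r : Fin n := ⟨s + 1, by omega⟩
  have hsr : s < r := Fin.lt_def.2 (Nat.lt_succ_self _)
  have hrt : r < t := Fin.lt_def.2 hst
  have hsr' := hsr.ne
  have hrt' := hrt.ne
  have hst' := (hsr.trans hrt).ne
  have hur := hu r
  by_cases hr : 1 ≤ u r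
  · refine ⟨Move u s r, fun j => ?_, .single (.inr ⟨s, r, hsr, hsm, hr, rfl⟩),
      .single (.inr ⟨r, t, hrt, ?_, ?_, funext fun j => ?_⟩)⟩
    · have := hu j
      grind [Move]
    all_goals grind [Move]
  · refine ⟨Move u r t, fun j => ?_, .single (.inr ⟨r, t, hrt, by omega, ht, rfl⟩),
      .single (.inr ⟨s, r, hsr, ?_, ?_, funext fun j => ?_⟩)⟩
    · have := hu j
      grind [Move]
    all_goals grind [Move]
end

section
/- Let u ∈ Γ with u_n ≤ m−1 and set v = Up(u,n). Then (u,v) is a covering pair of the poset (Γ, ≼_UM): u ≺_UM v, and every w ∈ Γ with u ≼_UM w ≼_UM v satisfies w ∈ {u,v}. -/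
open Finset

/-- Total of the entries of `u`, where the entry at position `j` (counted from `0`) has weight
`n - j`; the first (most recent) period weighs most and the last one has weight `1`. -/
def weightedSum {n : ℕ} (u : Fin n → ℕ) : ℕ := ∑ j : Fin n, (n - (j : ℕ)) * u j

theorem weightedSum_Up {n : ℕ} (u : Fin n → ℕ) (s : Fin n) :
    weightedSum (Up u s) = weightedSum u + (n - (s : ℕ)) := by
  have h : ∀ j : Fin n, (n - (j : ℕ)) * Up u s j =
      (n - (j : ℕ)) * u j + if j = s then n - (s : ℕ) else 0 := by
    intro j
    by_cases hj : j = s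
    · subst hj
      simp [Up, mul_add]
    · simp [Up, hj]
  simp [weightedSum, h, Finset.sum_add_distrib]

theorem Up_Move {n : ℕ} {u : Fin n → ℕ} {s t : Fin n} (hst : s ≠ t) (ht : 1 ≤ u t) :
    Up (Move u s t) t = Up u s := by
  funext j
  by_cases hj : j = t
  · subst hj
    simp [Up, Move, hst.symm, Nat.sub_add_cancel ht]
  · simp [Up, Move, hj]

theorem UMStep.weightedSum_lt {n m : ℕ} {u v : Fin n → ℕ} (h : UMStep m u v) :
    weightedSum u < weightedSum v := by
  rcases h with ⟨s, -, rfl⟩ | ⟨s, t, hst, -, ht, rfl⟩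
  · have := weightedSum_Up u s
    omega
  · have h₁ := weightedSum_Up (Move u s t) t
    have h₂ := weightedSum_Up u s
    rw [Up_Move hst.ne ht] at h₁
    have : (s : ℕ) < t := hst
    omega

theorem UMLt.weightedSum_lt {n m : ℕ} {u v : Fin n → ℕ} (h : UMLt m u v) :
    weightedSum u < weightedSum v := by
  induction h with
  | single h => exact UMStep.weightedSum_lt h
  | tail _ h ih => exact ih.trans (UMStep.weightedSum_lt h)

theorem stmt_12 (n m : ℕ) (hn : 0 < n) (hm : 0 < m)
    (u : Fin n → ℕ) (hu : InGamma m u)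
    (hs : u ⟨n - 1, Nat.sub_lt hn Nat.one_pos⟩ ≤ m - 1)
    (v : Fin n → ℕ) (hv : v = Up u ⟨n - 1, Nat.sub_lt hn Nat.one_pos⟩) :
    UMLt m u v ∧
      ∀ w : Fin n → ℕ, InGamma m w → UMLe m u w → UMLe m w v → (w = u ∨ w = v) := by
  subst hv
  refine ⟨.single (.inl ⟨_, hs, rfl⟩), ?_⟩
  rintro w - (huw | rfl) hwv
  · rcases hwv with hwv | rfl
    · have h₁ := huw.weightedSum_lt
      have h₂ := hwv.weightedSum_lt
      rw [weightedSum_Up] at h₂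
      simp only at h₂
      omega
    · exact .inr rfl
  · exact .inl rfl
end

section
/- Let u ∈ Γ and s ∈ [1,n−1] with u_s ≤ m−1 and u_{s+1} ≥ 1, and set v = Move(u,s,s+1). Then (u,v) is a covering pair of the poset (Γ, ≼_UM): u ≺_UM v, and every w ∈ Γ with u ≼_UM w ≼_UM v satisfies w ∈ {u,v}. -/
open Finset

/-- The sum of the entries of `u` at the positions below `k`. -/
def prefixSum {n : ℕ} (u : Fin n → ℕ) (k : ℕ) : ℕ :=
  ∑ j ∈ univ.filter (fun i : Fin n => (i : ℕ) < k), u j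

theorem prefixSum_succ {n : ℕ} (u : Fin n → ℕ) (j : Fin n) :
    prefixSum u (j + 1) = prefixSum u j + u j := by
  have h : (univ.filter fun i : Fin n => (i : ℕ) < j + 1) =
      insert j (univ.filter fun i : Fin n => (i : ℕ) < j) := by
    ext i
    simp only [mem_filter, mem_univ, true_and, mem_insert, Fin.ext_iff]
    omega
  rw [prefixSum, h, sum_insert (by simp), add_comm, prefixSum]

theorem eq_of_prefixSum_eq {n : ℕ} {u v : Fin n → ℕ}
    (h : ∀ k, prefixSum u k = prefixSum v k) : u = v := by
  funext j
  have h1 := h (j + 1)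
  rw [prefixSum_succ, prefixSum_succ, h j] at h1
  exact Nat.add_left_cancel h1

theorem prefixSum_le_prefixSum_Up {n : ℕ} (u : Fin n → ℕ) (s : Fin n) (k : ℕ) :
    prefixSum u k ≤ prefixSum (Up u s) k := by
  refine sum_le_sum fun j _ => ?_
  unfold Up
  split_ifs with h
  · rw [h]
    exact Nat.le_succ _
  · exact le_rfl

theorem prefixSum_Move {n : ℕ} {u : Fin n → ℕ} {s t : Fin n} (hst : s ≠ t) (ht : 1 ≤ u t)
    (k : ℕ) :
    prefixSum (Move u s t) k + (if (t : ℕ) < k then 1 else 0) =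
      prefixSum u k + (if (s : ℕ) < k then 1 else 0) := by
  have h : ∀ j, Move u s t j + (if j = t then 1 else 0) = u j + (if j = s then 1 else 0) := by
    intro j
    unfold Move
    by_cases hs : j = s
    · subst hs
      simp [hst]
    · by_cases hj : j = t
      · subst hj
        simp [hs, ht]
      · simp [hs, hj]
  have h' := sum_congr (rfl : (univ.filter fun i : Fin n => (i : ℕ) < k) = _) fun j _ => h j
  simpa [sum_add_distrib, prefixSum] using h'

theorem UMStep.prefixSum_le {n m : ℕ} {u v : Fin n → ℕ} (h : UMStep m u v) (k : ℕ) :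
    prefixSum u k ≤ prefixSum v k := by
  rcases h with ⟨s, -, rfl⟩ | ⟨s, t, hst, -, ht, rfl⟩
  · exact prefixSum_le_prefixSum_Up u s k
  · have h := prefixSum_Move hst.ne ht k
    have hst' : (s : ℕ) < t := hst
    split_ifs at h <;> omega

theorem UMLe.prefixSum_le {n m : ℕ} {u v : Fin n → ℕ} (h : UMLe m u v) (k : ℕ) :
    prefixSum u k ≤ prefixSum v k := by
  rcases h with h | rfl
  · induction h with
    | single h => exact h.prefixSum_le k
    | tail _ h ih => exact ih.trans (h.prefixSum_le k)
  · exact le_rfl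

theorem stmt_13 (n m : ℕ) (hn : 0 < n) (hm : 0 < m)
    (u : Fin n → ℕ) (hu : InGamma m u) (s t : Fin n)
    (hst : (s : ℕ) + 1 = (t : ℕ)) (hsm : u s ≤ m - 1) (ht : 1 ≤ u t)
    (v : Fin n → ℕ) (hv : v = Move u s t) :
    UMLt m u v ∧
      ∀ w : Fin n → ℕ, InGamma m w → UMLe m u w → UMLe m w v → (w = u ∨ w = v) := by
  subst hv
  have hlt : s < t := Fin.lt_def.2 (by omega)
  refine ⟨.single (.inr ⟨s, t, hlt, hsm, ht, rfl⟩), fun w _ huw hwv => ?_⟩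
  have hmove := prefixSum_Move hlt.ne ht
  have hne : ∀ k, k ≠ (t : ℕ) → prefixSum u k = prefixSum (Move u s t) k := by
    intro k hk
    have h := hmove k
    split_ifs at h <;> omega
  have heq : prefixSum (Move u s t) t = prefixSum u t + 1 := by
    have h := hmove t
    split_ifs at h <;> omega
  have hle := huw.prefixSum_le
  have hge := hwv.prefixSum_le
  have hcases : prefixSum w t = prefixSum u t ∨ prefixSum w t = prefixSum (Move u s t) t := by
    have h1 := hle t
    have h2 := hge t
    omega
  refine hcases.imp (fun h => ?_) (fun h => ?_) <;>
  · refine eq_of_prefixSum_eq fun k => ?_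
    by_cases hk : k = (t : ℕ)
    · rw [hk, h]
    · have h1 := hle k
      have h2 := hge k
      have h3 := hne k hk
      omega
end

section
/- Let u ∈ Γ and s ∈ [1,n] with u_s ≤ m−1, and suppose there exists j ∈ [s+1,n] with u_j ∈ {u_s, u_s+1}. Then there exists w ∈ Γ with u ≺_US w ≺_US Up(u,s); consequently, (u, Up(u,s)) is not a covering pair of (Γ, ≼_US). -/
open Finset

theorem stmt_14 (n m : ℕ) (hn : 0 < n) (hm : 0 < m)
    (u : Fin n → ℕ) (hu : InGamma m u) (s : Fin n) (hsm : u s ≤ m - 1)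
    (hj : ∃ j : Fin n, s < j ∧ (u j = u s ∨ u j = u s + 1)) :
    ∃ w : Fin n → ℕ, InGamma m w ∧ USLt m u w ∧ USLt m w (Up u s) := by
  obtain ⟨j, hsj, h | h⟩ := hj
  · refine ⟨Up u j, fun k => ?_, .single (.inl ⟨j, by omega, rfl⟩),
      .single (.inr ⟨s, j, hsj, ?_, ?_⟩)⟩
    · have := hu k
      unfold Up
      split_ifs <;> omega
    · simp [Up, hsj.ne, h]
    · ext k
      simp only [Up, Swap]
      grind
  · refine ⟨Swap u s j, fun k => ?_, .single (.inr ⟨s, j, hsj, by omega, rfl⟩),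
      .single (.inl ⟨j, ?_, ?_⟩)⟩
    · unfold Swap
      split_ifs <;> exact hu _
    · simpa [Swap, hsj.ne'] using hsm
    · ext k
      simp only [Up, Swap]
      grind
end

section
/- Let u ∈ Γ and s,t ∈ [1,n] with s < t and u_s < u_t, and suppose there exists j ∈ [s+1,t−1] with u_s ≤ u_j ≤ u_t. Then there exists w ∈ Γ with u ≺_US w ≺_US Swap(u,s,t); consequently, (u, Swap(u,s,t)) is not a covering pair of (Γ, ≼_US). -/
open Finset

theorem InGamma.swap {n m : ℕ} {u : Fin n → ℕ} (hu : InGamma m u) (s t : Fin n) :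
    InGamma m (Swap u s t) := by
  intro i
  unfold Swap
  split_ifs <;> exact hu _

theorem USLt.swap (m : ℕ) {n : ℕ} {u : Fin n → ℕ} {s t : Fin n} (hst : s < t)
    (hut : u s < u t) : USLt m u (Swap u s t) :=
  Relation.TransGen.single (Or.inr ⟨s, t, hst, hut, rfl⟩)

theorem stmt_15 (n m : ℕ) (hn : 0 < n) (hm : 0 < m)
    (u : Fin n → ℕ) (hu : InGamma m u) (s t : Fin n) (hst : s < t)
    (hut : u s < u t)
    (hj : ∃ j : Fin n, s < j ∧ j < t ∧ u s ≤ u j ∧ u j ≤ u t) :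
    ∃ w : Fin n → ℕ, InGamma m w ∧ USLt m u w ∧ USLt m w (Swap u s t) := by
  obtain ⟨j, hsj, hjt, hsj', hjt'⟩ := hj
  have hjs : j ≠ s := hsj.ne'
  have htj : t ≠ j := hjt.ne'
  have hts : t ≠ s := hst.ne'
  rcases hsj'.eq_or_lt with hab | hab
  · refine ⟨Swap u j t, hu.swap j t, USLt.swap m hjt (by omega), ?_⟩
    have key : Swap u s t = Swap (Swap u j t) s j := by
      funext i
      simp only [Swap]
      grind
    rw [key]
    exact USLt.swap m hsj (by simpa [Swap, hjs.symm, hts.symm] using hut)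
  · refine ⟨Swap u s j, hu.swap s j, USLt.swap m hsj hab, ?_⟩
    rcases hjt'.eq_or_lt with hbc | hbc
    · have key : Swap u s t = Swap (Swap u s j) j t := by
        funext i
        simp only [Swap]
        grind
      rw [key]
      exact USLt.swap m hjt (by simpa [Swap, hjs, htj, hts] using hut)
    · have key : Swap u s t = Swap (Swap (Swap u s j) s t) j t := by
        funext i
        simp only [Swap]
        grind
      rw [key]
      refine (USLt.swap m hst ?_).trans (USLt.swap m hjt ?_)
      · simpa [Swap, htj, hts] using hbc
      · simpa [Swap, hjs, htj.symm, hts] using hab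
end

section
/- Let u ∈ Γ and s ∈ [1,n] with u_s ≤ m−1 and u_j ∉ {u_s, u_s+1} for all j ∈ [s+1,n], and set v = Up(u,s). Then (u,v) is a covering pair of the poset (Γ, ≼_US): u ≺_US v, and every w ∈ Γ with u ≼_US w ≼_US v satisfies w ∈ {u,v}. -/
open Finset

/-- The number of positions `j < k` at which the entry of `u` is at least `c`. -/
def prefixCount {n : ℕ} (k c : ℕ) (u : Fin n → ℕ) : ℕ :=
  #{j : Fin n | j.val < k ∧ c ≤ u j}

theorem prefixCount_succ {n : ℕ} (c : ℕ) (u : Fin n → ℕ) (i : Fin n) :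
    prefixCount (i.val + 1) c u = prefixCount i.val c u + if c ≤ u i then 1 else 0 := by
  unfold prefixCount
  split_ifs with h
  · rw [← Finset.card_insert_of_notMem (a := i) (by simp)]
    congr 1
    ext j
    simp only [mem_filter, mem_univ, true_and, mem_insert]
    grind
  · rw [add_zero]
    congr 1
    ext j
    simp only [mem_filter, mem_univ, true_and]
    grind

theorem prefixCount_congr {n k c : ℕ} {u v : Fin n → ℕ}
    (h : ∀ j : Fin n, j.val < k → (c ≤ u j ↔ c ≤ v j)) :
    prefixCount k c u = prefixCount k c v := by
  unfold prefixCount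
  congr 1
  ext j
  simp only [mem_filter, mem_univ, true_and]
  exact and_congr_right (h j)

theorem prefixCount_mono {n k c : ℕ} {u v : Fin n → ℕ}
    (h : ∀ j : Fin n, j.val < k → u j ≤ v j) :
    prefixCount k c u ≤ prefixCount k c v := by
  refine Finset.card_le_card fun j hj => ?_
  simp only [mem_filter, mem_univ, true_and] at hj ⊢
  exact ⟨hj.1, hj.2.trans (h j hj.1)⟩

theorem prefixCount_le_swap {n : ℕ} (k c : ℕ) {u : Fin n → ℕ} {s t : Fin n}
    (hst : s < t) (hlt : u s < u t) :
    prefixCount k c u ≤ prefixCount k c (Swap u s t) := by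
  by_cases hk : t.val < k
  · refine Finset.card_le_card_of_injOn (Equiv.swap s t) (fun j hj => ?_)
      (Equiv.swap s t).injective.injOn
    simp only [coe_filter, mem_univ, true_and, Set.mem_ofPred_eq, Swap,
      Equiv.swap_apply_def] at hj ⊢
    grind
  · refine prefixCount_mono fun j hj => ?_
    unfold Swap
    grind

theorem USStep.prefixCount_le {n m : ℕ} {u v : Fin n → ℕ} (h : USStep m u v) (k c : ℕ) :
    prefixCount k c u ≤ prefixCount k c v := by
  rcases h with ⟨s, -, rfl⟩ | ⟨s, t, hst, hlt, rfl⟩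
  · refine prefixCount_mono fun j _ => ?_
    unfold Up
    grind
  · exact prefixCount_le_swap k c hst hlt

theorem USLe.prefixCount_le {n m : ℕ} {u v : Fin n → ℕ} (h : USLe m u v) (k c : ℕ) :
    prefixCount k c u ≤ prefixCount k c v := by
  rcases h with h | rfl
  · induction h with
    | single h => exact h.prefixCount_le k c
    | tail _ h ih => exact ih.trans (h.prefixCount_le k c)
  · exact le_rfl

/-- If `u` and `v` agree at threshold `c` up to position `i`, then so does everything
between them. -/
theorem USLe.le_iff_le_of_between {n m c : ℕ} {u v w : Fin n → ℕ} (huw : USLe m u w)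
    (hwv : USLe m w v) (i : Fin n) (h : ∀ j ≤ i, c ≤ u j ↔ c ≤ v j) :
    c ≤ u i ↔ c ≤ w i := by
  have hcount : ∀ k ≤ i.val + 1, prefixCount k c u = prefixCount k c w := fun k hk =>
    le_antisymm (huw.prefixCount_le k c) ((hwv.prefixCount_le k c).trans_eq
      (prefixCount_congr fun j hj => h j (by rw [Fin.le_def]; omega)).symm)
  have h1 := hcount (i.val + 1) le_rfl
  rw [prefixCount_succ, prefixCount_succ, hcount i.val (Nat.le_succ _)] at h1
  grind

theorem stmt_16 (n m : ℕ) (hn : 0 < n) (hm : 0 < m)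
    (u : Fin n → ℕ) (hu : InGamma m u) (s : Fin n) (hsm : u s ≤ m - 1)
    (hcond : ∀ j : Fin n, s < j → u j ≠ u s ∧ u j ≠ u s + 1)
    (v : Fin n → ℕ) (hv : v = Up u s) :
    USLt m u v ∧
      ∀ w : Fin n → ℕ, InGamma m w → USLe m u w → USLe m w v → (w = u ∨ w = v) := by
  subst hv
  refine ⟨.single (.inl ⟨s, hsm, rfl⟩), fun w _ huw hwv => ?_⟩
  have hthreshold : ∀ (i : Fin n) (c : ℕ), (c ≠ u s + 1 ∨ i < s) → (c ≤ u i ↔ c ≤ w i) := by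
    intro i c hc
    refine huw.le_iff_le_of_between hwv i fun j hj => ?_
    unfold Up
    grind
  have hne : ∀ i, i ≠ s → w i = u i := by
    intro i hi
    have h1 := hthreshold i (u i)
    have h2 := hthreshold i (u i + 1)
    rcases lt_or_gt_of_ne hi with hlt | hgt
    · have := h2 (.inr hlt)
      have := h1 (.inr hlt)
      omega
    · obtain ⟨hk, hk1⟩ := hcond i hgt
      have := h2 (.inl (by omega))
      have := h1 (.inl hk1)
      omega
  have hlow := hthreshold s (u s) (.inl (by omega))
  have hhigh := hthreshold s (u s + 2) (.inl (by omega))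
  rcases (by omega : w s = u s ∨ w s = u s + 1) with hs | hs
  · left
    funext i
    by_cases hi : i = s
    · rw [hi, hs]
    · exact hne i hi
  · right
    funext i
    unfold Up
    split_ifs with hi
    · rw [hi, hs]
    · exact hne i hi
end
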